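/- For every 0 ≤ q < n and all natural numbers z₁, z₂ with z₁ + a z₂ ≡ i_q − iₙ (mod r) (note iₙ = 1), there is a path in the labelled quiver from vertex n to vertex q with total label (z₁, z₂). (Every map S_{iₙ} → S_{i_q} can be seen in the diagram of special Cohen–Macaulay modules.) -/

import Mathlib

/-- The two-step linear recursion `s₀ = x0`, `s₁ = x1`, `s_{t+1} = α_t s_t − s_{t−1}`;
with `x0 = r, x1 = a` this is the i-series and with `x0 = 0, x1 = 1` the j-series. -/
def ser (x0 x1 : ℤ) (α : ℕ → ℕ) : ℕ → ℤ
  | 0 => x0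
  | 1 => x1
  | t + 2 => (α (t + 1) : ℤ) * ser x0 x1 α (t + 1) - ser x0 x1 α t

/-- Hirzebruch–Jung (negative) continued fraction value of a list. -/
def hj : List ℚ → ℚ
  | [] => 0
  | q :: L => q - 1 / hj L

/-- `Arrow r a n α v w ℓ` : there is an arrow `v → w` with label `ℓ = (ℓ₁, ℓ₂)` in the
labelled quiver of the diagram of special CM modules: clockwise arrows `t → t−1` with
label `(i_{t−1} − i_t, 0)` and `0 → n` with label `(1,0)`; anticlockwise arrows
`t → t+1` with label `(0, j_{t+1} − j_t)` and `n → 0` with label `(0, r − jₙ)`; and for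
`1 ≤ t ≤ n`, `1 ≤ s ≤ α_t − 2`, extra arrows `t → 0` with label
`(i_{t−1} − (s+1) i_t, s j_t − j_{t−1})`. -/
def Arrow (r a n : ℕ) (α : ℕ → ℕ) (v w : ℕ) (ℓ : ℕ × ℕ) : Prop :=
  (∃ t, 1 ≤ t ∧ t ≤ n ∧ v = t ∧ w = t - 1 ∧
    ℓ = ((ser r a α (t - 1) - ser r a α t).toNat, 0)) ∨
  (v = 0 ∧ w = n ∧ ℓ = (1, 0)) ∨
  (∃ t, t + 1 ≤ n ∧ v = t ∧ w = t + 1 ∧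
    ℓ = (0, (ser 0 1 α (t + 1) - ser 0 1 α t).toNat)) ∨
  (v = n ∧ w = 0 ∧ ℓ = (0, ((r : ℤ) - ser 0 1 α n).toNat)) ∨
  (∃ t s, 1 ≤ t ∧ t ≤ n ∧ 1 ≤ s ∧ s ≤ α t - 2 ∧ v = t ∧ w = 0 ∧
    ℓ = ((ser r a α (t - 1) - ((s : ℤ) + 1) * ser r a α t).toNat,
         ((s : ℤ) * ser 0 1 α t - ser 0 1 α (t - 1)).toNat))

/-- One step of the labelled quiver: move along an arrow, adding its label to the
running total. -/
def StepQ (r a n : ℕ) (α : ℕ → ℕ) (x y : ℕ × ℕ × ℕ) : Prop :=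
  ∃ ℓ : ℕ × ℕ, Arrow r a n α x.1 y.1 ℓ ∧ y.2.1 = x.2.1 + ℓ.1 ∧ y.2.2 = x.2.2 + ℓ.2

/-- There is a path from vertex `p` to vertex `q` with total label `(z₁, z₂)`. -/
def HasPath (r a n : ℕ) (α : ℕ → ℕ) (p q z₁ z₂ : ℕ) : Prop :=
  Relation.ReflTransGen (StepQ r a n α) (p, 0, 0) (q, z₁, z₂)

theorem ser_succ_eq_shift (x0 x1 : ℤ) (α : ℕ → ℕ) (t : ℕ) :
    ser x0 x1 α (t + 1) = ser x1 ((α 1 : ℤ) * x1 - x0) (fun k => α (k + 1)) t := by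
  induction t using Nat.twoStepInduction with
  | zero => rfl
  | one => rfl
  | more t h0 h1 =>
    change (α (t + 1 + 1) : ℤ) * ser x0 x1 α (t + 1 + 1) - ser x0 x1 α (t + 1) = _
    rw [h0, h1]
    rfl

theorem one_lt_hj {α : ℕ → ℕ} {n : ℕ} (hn : 1 ≤ n) (hα : ∀ t, 1 ≤ t → t ≤ n → 2 ≤ α t) :
    1 < hj ((List.range n).map fun t => (α (t + 1) : ℚ)) := by
  induction n, hn using Nat.le_induction generalizing α with
  | base =>
    have h := hα 1 le_rfl le_rfl
    have h' : (2 : ℚ) ≤ α 1 := by exact_mod_cast h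
    simp [hj]
    linarith
  | succ n hn ih =>
    have h' : (2 : ℚ) ≤ α 1 := by exact_mod_cast hα 1 le_rfl (by omega)
    have hrec := ih (α := fun k => α (k + 1)) fun t h1 h2 => hα _ (by omega) (by omega)
    have hinv : 1 / hj ((List.range n).map fun t => (α (t + 1 + 1) : ℚ)) < 1 := by
      rw [div_lt_one (by linarith)]
      exact hrec
    rw [List.range_succ_eq_map, List.map_cons, List.map_map]
    change 1 < (α 1 : ℚ) - 1 / hj ((List.range n).map fun t => (α (t + 1 + 1) : ℚ))
    linarith

/-- If `x0 / x1` has the continued fraction expansion `[α₁, …, αₙ]`, then the series started at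
`x0, x1` strictly decreases until it reaches `0` at index `n + 1`. -/
theorem ser_strictAnti_of_hj {n : ℕ} (hn : 1 ≤ n) {α : ℕ → ℕ} {x0 x1 : ℤ}
    (hα : ∀ t, 1 ≤ t → t ≤ n → 2 ≤ α t) (hx1 : 0 < x1)
    (hval : hj ((List.range n).map fun t => (α (t + 1) : ℚ)) = (x0 : ℚ) / (x1 : ℚ)) :
    (∀ t ≤ n, ser x0 x1 α (t + 1) < ser x0 x1 α t) ∧ ser x0 x1 α (n + 1) = 0 := by
  induction n, hn using Nat.le_induction generalizing α x0 x1 with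
  | base =>
    have hq : (0 : ℚ) < x1 := by exact_mod_cast hx1
    have hgt := one_lt_hj le_rfl hα
    rw [hval, one_lt_div hq] at hgt
    have hlt : x1 < x0 := by exact_mod_cast hgt
    have heq : (α 1 : ℤ) * x1 - x0 = 0 := by
      have : (α 1 : ℚ) * x1 - x0 = 0 := by
        have h : (α 1 : ℚ) = x0 / x1 := by simpa [hj] using hval
        rw [h]
        field_simp
        ring
      exact_mod_cast this
    refine ⟨fun t ht => ?_, heq⟩
    interval_cases t
    · exact hlt
    · change (α 1 : ℤ) * x1 - x0 < x1
      omega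
  | succ n hn ih =>
    have hq : (0 : ℚ) < x1 := by exact_mod_cast hx1
    have hgt := one_lt_hj (by omega) hα
    rw [hval, one_lt_div hq] at hgt
    have hlt : x1 < x0 := by exact_mod_cast hgt
    have hα' : ∀ t, 1 ≤ t → t ≤ n → 2 ≤ α (t + 1) := fun t h1 h2 => hα _ (by omega) (by omega)
    have htail := one_lt_hj (α := fun k => α (k + 1)) hn hα'
    rw [List.range_succ_eq_map, List.map_cons, List.map_map] at hval
    change (α 1 : ℚ) - 1 / hj ((List.range n).map fun t => (α (t + 1 + 1) : ℚ)) = _ at hval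
    generalize hh : hj ((List.range n).map fun t => (α (t + 1 + 1) : ℚ)) = h at hval htail
    have hpos : 0 < h := by linarith
    have hx2 : (((α 1 : ℤ) * x1 - x0 : ℤ) : ℚ) = x1 / h := by
      push_cast
      field_simp at hval ⊢
      linarith
    have hx2pos : 0 < (α 1 : ℤ) * x1 - x0 := by
      have : (0 : ℚ) < (((α 1 : ℤ) * x1 - x0 : ℤ) : ℚ) := by rw [hx2]; positivity
      exact_mod_cast this
    obtain ⟨h1, h2⟩ := ih (α := fun k => α (k + 1)) (x0 := x1) hα' hx2pos
      (by rw [hx2, hh]; field_simp)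
    refine ⟨fun t ht => ?_, by rw [ser_succ_eq_shift]; exact h2⟩
    rcases t with _ | t
    · exact hlt
    · rw [ser_succ_eq_shift x0 x1 α (t + 1), ser_succ_eq_shift x0 x1 α t]
      exact h1 t (by omega)

theorem isCoprime_ser {x0 x1 : ℤ} (α : ℕ → ℕ) (h : IsCoprime x0 x1) (t : ℕ) :
    IsCoprime (ser x0 x1 α t) (ser x0 x1 α (t + 1)) := by
  induction t with
  | zero => exact h
  | succ t ih =>
    obtain ⟨u, v, huv⟩ := ih
    refine ⟨v + u * α (t + 1), -u, ?_⟩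
    change _ + -u * ((α (t + 1) : ℤ) * ser x0 x1 α (t + 1) - ser x0 x1 α t) = 1
    linear_combination huv

theorem ser_det (r a : ℤ) (α : ℕ → ℕ) (t : ℕ) :
    ser r a α t * ser 0 1 α (t + 1) - ser r a α (t + 1) * ser 0 1 α t = r := by
  induction t with
  | zero => simp [ser]
  | succ t ih =>
    simp only [ser]
    linear_combination ih

theorem dvd_ser_sub_mul_ser (r a : ℤ) (α : ℕ → ℕ) (t : ℕ) :
    r ∣ ser r a α t - a * ser 0 1 α t := by
  induction t using Nat.twoStepInduction with
  | zero => simp [ser]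
  | one => simp [ser]
  | more t h0 h1 =>
    have := (h1.mul_left (α (t + 1) : ℤ)).sub h0
    simp only [ser]
    refine this.trans (dvd_of_eq ?_)
    ring

theorem ser_zero_one_strictMono {n : ℕ} {α : ℕ → ℕ} (hα : ∀ t, 1 ≤ t → t ≤ n → 2 ≤ α t) :
    ∀ t ≤ n, 0 ≤ ser 0 1 α t ∧ ser 0 1 α t < ser 0 1 α (t + 1) := by
  intro t
  induction t with
  | zero => simp [ser]
  | succ t ih =>
    intro ht
    obtain ⟨h0, h1⟩ := ih (by omega)
    have h2 : (2 : ℤ) ≤ α (t + 1) := by exact_mod_cast hα (t + 1) (by omega) ht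
    refine ⟨by omega, ?_⟩
    change _ < (α (t + 1) : ℤ) * ser 0 1 α (t + 1) - ser 0 1 α t
    nlinarith

/-- No point of the lattice `m ≡ a z (mod r)` with `m > 0` and `z ≥ 0` lies strictly below
`(i₁, j₁)` in both coordinates. -/
theorem no_lattice_point_below {r a i₀ i₁ j₀ j₁ m z : ℤ} (hr : 0 < r) (hi : i₁ < i₀)
    (hj : j₀ < j₁) (hdet : i₀ * j₁ - i₁ * j₀ = r)
    (h₀ : r ∣ i₀ - a * j₀) (h₁ : r ∣ i₁ - a * j₁) (hmz : r ∣ m - a * z)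
    (hm : 0 < m) (hmi : m < i₁) (hz : 0 ≤ z) (hzj : z < j₁) : False := by
  obtain ⟨A, hA⟩ : r ∣ m * j₁ - z * i₁ := by
    have := (hmz.mul_right j₁).sub (h₁.mul_right z)
    refine this.trans (dvd_of_eq ?_)
    ring
  obtain ⟨B, hB⟩ : r ∣ z * i₀ - m * j₀ := by
    have := (h₀.mul_right z).sub (hmz.mul_right j₀)
    refine this.trans (dvd_of_eq ?_)
    ring
  have hm' : m = A * i₀ + B * i₁ := by
    apply mul_left_cancel₀ hr.ne'
    linear_combination i₀ * hA + i₁ * hB - m * hdet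
  have hz' : z = A * j₀ + B * j₁ := by
    apply mul_left_cancel₀ hr.ne'
    linear_combination j₀ * hA + j₁ * hB - z * hdet
  rcases lt_trichotomy A 0 with hneg | rfl | hpos
  · have hAB : 1 ≤ A + B := by
      by_contra hcon
      nlinarith
    nlinarith
  · have hB1 : 0 < B := by
      by_contra hcon
      nlinarith
    nlinarith
  · have hAB : 1 ≤ A + B := by
      by_contra hcon
      nlinarith
    nlinarith

/-- Every `(u, v)` with `u, v ≥ 1` and `u + a v ≡ 0 (mod r)` dominates one of the invariants
`(r, 0)`, `(0, r)`, `(i_{t-1} - s i_t, s j_t - j_{t-1})`. -/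
theorem exists_invariant_le {r a n : ℕ} {α : ℕ → ℕ} (hr : 0 < r) (har : a < r)
    (hn : 1 ≤ n) (hα : ∀ t, 1 ≤ t → t ≤ n → 2 ≤ α t)
    (hi : ∀ t ≤ n, ser r a α (t + 1) < ser r a α t) (hin : ser r a α n = 1)
    (hin' : ser r a α (n + 1) = 0) (hjn : ser 0 1 α (n + 1) = r)
    {u v : ℤ} (hu : 1 ≤ u) (hv : 1 ≤ v) (huv : (r : ℤ) ∣ u + a * v) :
    (r : ℤ) ≤ u ∨ (r : ℤ) ≤ v ∨ ∃ t < n, ∃ s : ℤ, 1 ≤ s ∧ s ≤ (α (t + 1) : ℤ) - 1 ∧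
      ser r a α t - s * ser r a α (t + 1) ≤ u ∧ s * ser 0 1 α (t + 1) - ser 0 1 α t ≤ v := by
  have hr' : (0 : ℤ) < r := by exact_mod_cast hr
  have hw : ∀ t, ∃ w : ℤ, u * ser 0 1 α t + v * ser r a α t = r * w := by
    intro t
    have := (huv.mul_right (ser 0 1 α t)).add ((dvd_ser_sub_mul_ser r a α t).mul_right v)
    obtain ⟨w, hw⟩ := this
    exact ⟨w, by rw [← hw]; ring⟩
  choose w hw using hw
  have hwrec : ∀ t, w (t + 2) = α (t + 1) * w (t + 1) - w t := by
    intro t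
    apply mul_left_cancel₀ hr'.ne'
    have h2 := hw (t + 2)
    simp only [ser] at h2
    linear_combination (α (t + 1) : ℤ) * hw (t + 1) - hw t - h2
  have hueq : ∀ t, u = w (t + 1) * ser r a α t - w t * ser r a α (t + 1) := by
    intro t
    apply mul_left_cancel₀ hr'.ne'
    linear_combination ser r a α t * hw (t + 1) - ser r a α (t + 1) * hw t
      - u * ser_det r a α t
  have hveq : ∀ t, v = w t * ser 0 1 α (t + 1) - w (t + 1) * ser 0 1 α t := by
    intro t
    apply mul_left_cancel₀ hr'.ne'
    linear_combination ser 0 1 α (t + 1) * hw t - ser 0 1 α t * hw (t + 1)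
      - v * ser_det r a α t
  have hj := ser_zero_one_strictMono hα
  by_cases hfirst : w 0 < w 1
  · left
    have h1 := hueq 0
    have h2 := hveq 0
    simp only [ser, zero_add, mul_one, mul_zero, sub_zero] at h1 h2
    have har' : (a : ℤ) < r := by exact_mod_cast har
    nlinarith
  by_cases hlast : w (n + 1) < w n
  · right; left
    have h1 := hueq n
    have h2 := hveq n
    have h3 := hj n le_rfl
    rw [hin, hin'] at h1
    rw [hjn] at h2 h3
    nlinarith
  right; right
  push Not at hfirst hlast
  have hex : ∃ t, w (t + 1) ≤ w (t + 2) := ⟨n - 1, by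
    obtain ⟨k, rfl⟩ : ∃ k, n = k + 1 := ⟨n - 1, by omega⟩
    simpa using hlast⟩
  classical
  have hmin : ∃ t < n, w (t + 1) ≤ w (t + 2) ∧ w (t + 1) ≤ w t := by
    refine ⟨Nat.find hex, ?_, Nat.find_spec hex, ?_⟩
    · have : Nat.find hex ≤ n - 1 := Nat.find_min' hex (by
        obtain ⟨k, rfl⟩ : ∃ k, n = k + 1 := ⟨n - 1, by omega⟩
        simpa using hlast)
      omega
    · rcases h : Nat.find hex with _ | k
      · exact hfirst
      · have := Nat.find_min hex (m := k) (by omega)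
        push Not at this
        exact this.le
  obtain ⟨t, ht, h1, h2⟩ := hmin
  refine ⟨t, ht, ?_⟩
  have hα1 : (2 : ℤ) ≤ α (t + 1) := by exact_mod_cast hα (t + 1) (by omega) (by omega)
  rw [hwrec] at h1
  have hi1 := hi t ht.le
  have hi2 := hi (t + 1) ht
  obtain ⟨hj1, hj2⟩ := hj t ht.le
  have hsi : ser r a α (t + 1 + 1) = α (t + 1) * ser r a α (t + 1) - ser r a α t := rfl
  have hipos : 0 ≤ ser r a α (t + 1) := by
    by_contra hneg
    have hanti : ∀ k, t + 1 + k ≤ n → ser r a α (t + 1 + k) < 0 := by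
      intro k
      induction k with
      | zero => intro _; simpa using hneg
      | succ k ih => intro hk; exact (hi (t + 1 + k) (by omega)).trans (ih (by omega))
    have := hanti (n - (t + 1)) (by omega)
    rw [show t + 1 + (n - (t + 1)) = n by omega, hin] at this
    omega
  have hw1 : 1 ≤ w (t + 1) := by
    by_contra hcon
    have : 0 < (r : ℤ) * w (t + 1) := by
      rw [← hw (t + 1)]
      have : 0 < ser 0 1 α (t + 1) := by omega
      positivity
    nlinarith
  have key : ∃ s : ℤ, 1 ≤ s ∧ s ≤ (α (t + 1) : ℤ) - 1 ∧ w (t + 1) - 1 ≤ w t - s ∧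
      w t - s ≤ ((α (t + 1) : ℤ) - 1) * (w (t + 1) - 1) := by
    refine ⟨max 1 (w t - ((α (t + 1) : ℤ) - 1) * (w (t + 1) - 1)), le_max_left _ _, ?_, ?_, ?_⟩
    · exact max_le (by linarith) (by linarith)
    · have : max 1 (w t - ((α (t + 1) : ℤ) - 1) * (w (t + 1) - 1)) ≤ w t - w (t + 1) + 1 :=
        max_le (by linarith) (by nlinarith)
      linarith
    · have := le_max_right 1 (w t - ((α (t + 1) : ℤ) - 1) * (w (t + 1) - 1))
      linarith
  obtain ⟨s, hs1, hs2, hs3, hs4⟩ := key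
  refine ⟨s, hs1, hs2, ?_, ?_⟩
  · rw [hueq t]
    have e1 : ((α (t + 1) : ℤ) - 1) * ser r a α (t + 1) ≤ ser r a α t := by linarith
    have e2 := mul_le_mul_of_nonneg_left e1 (by linarith : 0 ≤ w (t + 1) - 1)
    have e3 := mul_le_mul_of_nonneg_right hs4 hipos
    linarith
  · rw [hveq t]
    have e1 := mul_le_mul_of_nonneg_left hj2.le (by linarith : 0 ≤ w (t + 1) - 1)
    have e2 := mul_le_mul_of_nonneg_right hs3 (by linarith : 0 ≤ ser 0 1 α (t + 1))
    linarith

theorem HasPath.snoc {r a n : ℕ} {α : ℕ → ℕ} {p v w z₁ z₂ y₁ y₂ : ℕ} {ℓ : ℕ × ℕ}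
    (h : HasPath r a n α p v y₁ y₂) (harr : Arrow r a n α v w ℓ)
    (h₁ : z₁ = y₁ + ℓ.1) (h₂ : z₂ = y₂ + ℓ.2) : HasPath r a n α p w z₁ z₂ :=
  Relation.ReflTransGen.tail h ⟨ℓ, harr, h₁, h₂⟩

theorem hasPath_of_modEq {r a n : ℕ} {α : ℕ → ℕ} (ha : 0 < a) (har : a < r)
    (hn : 1 ≤ n) (hα : ∀ t, 1 ≤ t → t ≤ n → 2 ≤ α t)
    (hi : ∀ t ≤ n, ser r a α (t + 1) < ser r a α t) (hin : ser r a α n = 1)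
    (hin' : ser r a α (n + 1) = 0) (hjn : ser 0 1 α (n + 1) = r)
    {q z₁ z₂ : ℕ} (hq : q ≤ n) (hz : (r : ℤ) ∣ z₁ + a * z₂ + 1 - ser r a α q) :
    HasPath r a n α n q z₁ z₂ := by
  have hr' : (0 : ℤ) < r := by omega
  have hjs := ser_zero_one_strictMono hα
  have hipos : ∀ t ≤ n, 1 ≤ ser r a α t := by
    intro t ht
    induction ht using Nat.decreasingInduction with
    | self => exact hin.ge
    | of_succ k hk ih => exact ih.trans (hi k (by omega)).le
  induction hN : z₁ + z₂ using Nat.strong_induction_on generalizing q z₁ z₂ with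
  | _ N ih =>
  subst hN
  -- extend a path to `v` by an arrow `v → q` with label `(A, B)`
  have back : ∀ (v : ℕ) (A B : ℤ), v ≤ n → 0 ≤ A → 0 ≤ B → 0 < A + B → A ≤ z₁ → B ≤ z₂ →
      (r : ℤ) ∣ A + a * B - ser r a α q + ser r a α v →
      Arrow r a n α v q (A.toNat, B.toNat) → HasPath r a n α n q z₁ z₂ := by
    intro v A B hv hA hB hAB hA1 hB2 hd harr
    lift A to ℕ using hA
    lift B to ℕ using hB
    simp only [Int.toNat_natCast] at harr
    norm_cast at hAB hA1 hB2
    have hp : HasPath r a n α n v (z₁ - A) (z₂ - B) := by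
      refine ih _ (by omega) hv ?_ rfl
      have := hz.sub hd
      push_cast [hA1, hB2]
      refine this.trans (dvd_of_eq ?_)
      ring
    exact hp.snoc harr (by simp; omega) (by simp; omega)
  have clockwise : q < n → ser r a α q - ser r a α (q + 1) ≤ z₁ →
      HasPath r a n α n q z₁ z₂ := by
    intro hqn hle
    have := hi q hq
    exact back (q + 1) (ser r a α q - ser r a α (q + 1)) 0 hqn (by omega) le_rfl (by omega) hle
      (by omega) (by simp) (Or.inl ⟨q + 1, by omega, hqn, rfl, rfl, rfl⟩)
  have anticlockwise : 1 ≤ q → ser 0 1 α q - ser 0 1 α (q - 1) ≤ z₂ →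
      HasPath r a n α n q z₁ z₂ := by
    intro hq1 hle
    obtain ⟨k, rfl⟩ : ∃ k, q = k + 1 := ⟨q - 1, by omega⟩
    rw [Nat.add_sub_cancel] at hle
    have := hjs k (by omega)
    refine back k 0 (ser 0 1 α (k + 1) - ser 0 1 α k) (by omega) le_rfl (by omega) (by omega)
      (by omega) hle ?_ (Or.inr <| Or.inr <| Or.inl ⟨k, hq, rfl, rfl, rfl⟩)
    have := (dvd_ser_sub_mul_ser r a α k).sub (dvd_ser_sub_mul_ser r a α (k + 1))
    refine this.trans (dvd_of_eq ?_)
    ring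
  rcases Nat.eq_zero_or_pos q with rfl | hq1
  · have hz0 : (r : ℤ) ∣ (z₁ + 1) + a * z₂ := by
      have := hz.add (dvd_refl (r : ℤ))
      simp only [ser] at this
      refine this.trans (dvd_of_eq ?_)
      ring
    have hjnr : ser 0 1 α n < r := by rw [← hjn]; exact (hjs n le_rfl).2
    have toZero : (r : ℤ) - ser 0 1 α n ≤ z₂ → HasPath r a n α n 0 z₁ z₂ := by
      intro hle
      refine back n 0 (r - ser 0 1 α n) le_rfl le_rfl (by omega) (by omega) (by omega) hle ?_
        (Or.inr <| Or.inr <| Or.inr <| Or.inl ⟨rfl, rfl, rfl⟩)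
      have := (dvd_ser_sub_mul_ser r a α n).add ((dvd_refl (r : ℤ)).mul_right ((a : ℤ) - 1))
      simp only [ser]
      refine this.trans (dvd_of_eq ?_)
      ring
    have hbig : (r : ℤ) ≤ z₁ + 1 → HasPath r a n α n 0 z₁ z₂ := by
      intro hle
      apply clockwise (by omega)
      simp only [ser]
      omega
    rcases Nat.eq_zero_or_pos z₂ with rfl | hz2
    · apply hbig
      apply Int.le_of_dvd (by omega)
      simpa using hz0
    rcases exists_invariant_le (by omega) har hn hα hi hin hin' hjn
      (u := z₁ + 1) (v := z₂) (by omega) (by omega) hz0 with h | h | ⟨t, ht, s, hs⟩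
    · exact hbig h
    · exact toZero (by have := (hjs n le_rfl).1; omega)
    · induction htn : n - t generalizing t s with
      | zero => omega
      | succ d ihd =>
        obtain ⟨hs1, hs2, hs3, hs4⟩ := hs
        have hα1 := hα (t + 1) (by omega) (by omega)
        have hi1 := hipos (t + 1) ht
        have hj1 := hjs t ht.le
        have hsi : ser r a α (t + 1 + 1) = α (t + 1) * ser r a α (t + 1) - ser r a α t := rfl
        have hsj : ser 0 1 α (t + 1 + 1) = α (t + 1) * ser 0 1 α (t + 1) - ser 0 1 α t := rfl
        rcases hs2.lt_or_eq with hlt | heq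
        · lift s to ℕ using by omega
          have hid := hi (t + 1) ht
          have e1 : ((s : ℤ) + 1) * ser r a α (t + 1) ≤
              ((α (t + 1) : ℤ) - 1) * ser r a α (t + 1) :=
            mul_le_mul_of_nonneg_right (by omega) (by omega)
          have e2 : 1 * ser 0 1 α (t + 1) ≤ (s : ℤ) * ser 0 1 α (t + 1) :=
            mul_le_mul_of_nonneg_right hs1 (by omega)
          refine back (t + 1) (ser r a α t - ((s : ℤ) + 1) * ser r a α (t + 1))
            (s * ser 0 1 α (t + 1) - ser 0 1 α t) ht (by linarith) (by linarith) (by linarith)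
            (by linarith) hs4 ?_ ?_
          · have := ((dvd_ser_sub_mul_ser r a α t).sub
              ((dvd_ser_sub_mul_ser r a α (t + 1)).mul_left s)).sub (dvd_refl (r : ℤ))
            simp only [ser] at this ⊢
            refine this.trans (dvd_of_eq ?_)
            ring
          · exact Or.inr <| Or.inr <| Or.inr <| Or.inr
              ⟨t + 1, s, by omega, ht, by omega, by omega, rfl, rfl, rfl⟩
        · subst heq
          have hv' : ser 0 1 α (t + 1 + 1) - ser 0 1 α (t + 1) ≤ z₂ := by linarith
          have hu' : ser r a α (t + 1) - ser r a α (t + 1 + 1) ≤ z₁ + 1 := by linarith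
          rcases (Nat.succ_le_of_lt ht).lt_or_eq with hlt | heq
          · refine ihd (t + 1) hlt 1 ⟨le_rfl, ?_, by simpa using hu', by simpa using hv'⟩
              (by omega)
            have := hα (t + 1 + 1) (by omega) (by omega)
            omega
          · apply toZero
            rw [← hjn, ← heq]
            exact hv'
  rcases hq.lt_or_eq with hqn | rfl
  · by_cases hc : ser r a α q - ser r a α (q + 1) ≤ z₁
    · exact clockwise hqn hc
    by_cases hd : ser 0 1 α q - ser 0 1 α (q - 1) ≤ z₂
    · exact anticlockwise hq1 hd
    exfalso
    obtain ⟨k, rfl⟩ : ∃ k, q = k + 1 := ⟨q - 1, by omega⟩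
    rw [Nat.add_sub_cancel] at hd
    have hj1 := hjs k (by omega)
    have hi1 := hipos (k + 1 + 1) hqn
    refine no_lattice_point_below (m := ser r a α (k + 1) - 1 - z₁) (z := z₂) hr'
      (hi k (by omega)) hj1.2 (ser_det r a α k)
      (dvd_ser_sub_mul_ser r a α k) (dvd_ser_sub_mul_ser r a α (k + 1)) ?_
      (by omega) (by omega) (by omega) (by omega)
    rw [← dvd_neg]
    refine hz.trans (dvd_of_eq ?_)
    ring
  · rcases Nat.eq_zero_or_pos z₁ with rfl | hz1
    · rcases Nat.eq_zero_or_pos z₂ with rfl | hz2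
      · exact Relation.ReflTransGen.refl
      apply anticlockwise hq1
      obtain ⟨k, rfl⟩ : ∃ k, q = k + 1 := ⟨q - 1, by omega⟩
      have hle : (r : ℤ) ≤ z₂ := by
        rw [hin] at hz
        have hcop : IsCoprime (r : ℤ) a := by
          obtain ⟨c, hc⟩ := dvd_ser_sub_mul_ser r a α (k + 1)
          rw [hin] at hc
          exact ⟨c, ser 0 1 α (k + 1), by linear_combination -hc⟩
        refine Int.le_of_dvd (by omega) (hcop.dvd_of_dvd_mul_left ?_)
        refine hz.trans (dvd_of_eq ?_)
        push_cast
        ring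
      have h1 := hjs k (by omega)
      have h2 := hjs (k + 1) le_rfl
      rw [Nat.add_sub_cancel]
      omega
    · refine back 0 1 0 (by omega) (by omega) le_rfl (by omega) (by omega) (by omega) ?_
        (Or.inr <| Or.inl ⟨rfl, rfl, rfl⟩)
      rw [hin]
      simp [ser]

/-- every map `S_{i_n} -> S_{i_q}` (for `q < n`) can be seen in the diagram
of special Cohen-Macaulay modules. -/
theorem stmt_8 (r a n : ℕ) (α : ℕ → ℕ)
    (ha : 1 ≤ a) (har : a < r) (hcop : Nat.Coprime r a) (hn : 1 ≤ n)
    (hα : ∀ t, 1 ≤ t → t ≤ n → 2 ≤ α t)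
    (hval : hj ((List.range n).map fun t => (α (t + 1) : ℚ)) = (r : ℚ) / (a : ℚ)) :
    ∀ q, q < n → ∀ z₁ z₂ : ℕ,
      ((z₁ : ℤ) + (a : ℤ) * (z₂ : ℤ)) ≡ ser r a α q - ser r a α n [ZMOD (r : ℤ)] →
      HasPath r a n α n q z₁ z₂ := by
  intro q hq z₁ z₂ hz
  obtain ⟨hi, hin'⟩ := ser_strictAnti_of_hj (x0 := r) (x1 := a) hn hα (by omega)
    (by rw [hval]; push_cast; rfl)
  have hin : ser r a α n = 1 := by
    have hc := isCoprime_ser α (Nat.isCoprime_iff_coprime.mpr hcop) n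
    rw [hin', isCoprime_zero_right, Int.isUnit_iff] at hc
    have := hi n le_rfl
    omega
  have hjn : ser 0 1 α (n + 1) = r := by
    have := ser_det r a α n
    rw [hin, hin'] at this
    linarith
  refine hasPath_of_modEq ha har hn hα hi hin hin' hjn hq.le ?_
  have := hz.symm.dvd
  rw [hin] at this
  refine this.trans (dvd_of_eq ?_)
  ring
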